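/- Assume that Z_{ijkl}(x) = 0 for all points x ∈ ℝ^n_+ and all indices i,j,k,l ∈ {1,…,n}. Then H_{ik}(x) = 0 for all x ∈ ℝ^n_+ and all i,k ∈ {1,…,n−1}. -/

import Mathlib

noncomputable section

open MeasureTheory Metric

/-- Euclidean space `ℝ^n`. -/
abbrev Euc (n : ℕ) := EuclideanSpace ℝ (Fin n)

/-- Partial derivative in the `i`-th coordinate direction. -/
def pd {n : ℕ} (i : Fin n) (f : Euc n → ℝ) : Euc n → ℝ :=
  fun x => fderiv ℝ f x (EuclideanSpace.single i 1)

/-- Kronecker delta. -/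
def kd {n : ℕ} (i k : Fin n) : ℝ := if i = k then 1 else 0

/-- The tensor `A_{ik}` associated to a symmetric two-tensor field `H`. -/
def Aop {n : ℕ} (H : Fin n → Fin n → Euc n → ℝ) (i k : Fin n) : Euc n → ℝ :=
  fun x =>
    (∑ m, pd i (pd m (H m k)) x) + (∑ m, pd m (pd k (H i m)) x)
      - (∑ m, pd m (pd m (H i k)) x)
      - (1 / ((n : ℝ) - 1)) * (∑ m, ∑ p, pd m (pd p (H m p)) x) * kd i k

/-- The tensor `Z_{ijkl}` associated to a symmetric two-tensor field `H`. -/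
def Zop {n : ℕ} (H : Fin n → Fin n → Euc n → ℝ) (i j k l : Fin n) : Euc n → ℝ :=
  fun x =>
    pd i (pd k (H j l)) x - pd i (pd l (H j k)) x - pd j (pd k (H i l)) x
      + pd j (pd l (H i k)) x
      + (1 / ((n : ℝ) - 2)) * (Aop H j l x * kd i k - Aop H j k x * kd i l
          - Aop H i l x * kd j k + Aop H i k x * kd j l)

/-- The finite set of multi-indices `α` with `2 ≤ |α| ≤ d`. -/
def MIdx (n d : ℕ) : Finset (Fin n → ℕ) :=
  (Fintype.piFinset fun _ : Fin n => Finset.range (d + 1)).filter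
    fun α => 2 ≤ ∑ i, α i ∧ ∑ i, α i ≤ d

section PartOne
set_option linter.all false
open MvPolynomial

variable {ι : Type} [Fintype ι] [DecidableEq ι]

def dl (a b : ι) : MvPolynomial ι ℝ := if a = b then 1 else 0

def Rl (h : ι → ι → MvPolynomial ι ℝ) (a b c d : ι) : MvPolynomial ι ℝ :=
  pderiv a (pderiv c (h b d)) - pderiv a (pderiv d (h b c)) - pderiv b (pderiv c (h a d))
    + pderiv b (pderiv d (h a c))

def KN (P : ι → ι → MvPolynomial ι ℝ) (a b c d : ι) : MvPolynomial ι ℝ :=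
  P b d * dl a c - P b c * dl a d - P a d * dl b c + P a c * dl b d

lemma pderiv_X' (a c : ι) : pderiv a (X c : MvPolynomial ι ℝ) = dl a c := by
  rw [pderiv_X, dl]
  simp [Pi.single_apply, eq_comm]

lemma pderiv_comm' (a c : ι) (p : MvPolynomial ι ℝ) :
    pderiv a (pderiv c p) = pderiv c (pderiv a p) := by
  classical
  ext m
  simp only [coeff_pderiv]
  by_cases hac : a = c
  · subst hac; rfl
  · simp [Finsupp.single_apply, hac, Ne.symm hac, add_right_comm m]
    ring_nf

lemma euler' {m : ℕ} {p : MvPolynomial ι ℝ} (hp : p.IsHomogeneous m) :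
    ∑ a, X a * pderiv a p = (m : MvPolynomial ι ℝ) * p := by
  rw [hp.sum_X_mul_pderiv, nsmul_eq_mul]

lemma sum_dl_mul (a : ι) (f : ι → MvPolynomial ι ℝ) : ∑ c, dl a c * f c = f a := by
  simp [dl]

lemma lap_r2 {m : ℕ} {g : MvPolynomial ι ℝ} (hg : g.IsHomogeneous m) :
    ∑ a, pderiv a (pderiv a ((∑ c, X c * X c) * g)) =
      (2 * (Fintype.card ι : MvPolynomial ι ℝ) + 4 * (m : MvPolynomial ι ℝ)) * g
        + (∑ c, X c * X c) * ∑ a, pderiv a (pderiv a g) := by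
  have h1 : ∀ a : ι, pderiv a (∑ c, X c * X c : MvPolynomial ι ℝ) = 2 * X a := by
    intro a
    rw [map_sum]
    simp only [pderiv_mul, pderiv_X']
    rw [Finset.sum_add_distrib, sum_dl_mul]
    simp only [mul_comm (X _) (dl _ _)]
    rw [sum_dl_mul]; ring
  have h2 : ∀ a : ι, pderiv a (pderiv a ((∑ c, X c * X c) * g)) =
      2 * g + 4 * (X a * pderiv a g) + (∑ c, X c * X c) * pderiv a (pderiv a g) := by
    intro a
    have h3 : pderiv a (2 : MvPolynomial ι ℝ) = 0 := by
      exact_mod_cast Derivation.map_natCast (pderiv a) 2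
    rw [pderiv_mul, h1, map_add, pderiv_mul, pderiv_mul, pderiv_mul, h1, h3, pderiv_X', dl,
      if_pos rfl]
    ring
  rw [Finset.sum_congr rfl fun a _ => h2 a, Finset.sum_add_distrib, Finset.sum_add_distrib,
    ← Finset.mul_sum, ← Finset.mul_sum, euler' hg]
  rw [← Finset.mul_sum]
  simp only [Finset.sum_const, Finset.card_univ, nsmul_eq_mul]
  ring

lemma pderiv_hom0 {p : MvPolynomial ι ℝ} (hp : p.IsHomogeneous 0) (a : ι) : pderiv a p = 0 := by
  rw [← totalDegree_zero_iff_isHomogeneous, totalDegree_eq_zero_iff_eq_C] at hp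
  rw [hp, pderiv_C]

lemma lap_zero (k : ℕ) : ∀ (f : MvPolynomial ι ℝ) (_ : f.IsHomogeneous k) (c : ℝ) (_ : 0 < c)
    (_ : (∑ c, X c * X c) * ∑ a, pderiv a (pderiv a f) = - (C c * f)), f = 0 := by
  induction k using Nat.strong_induction_on with
  | _ k ih =>
  intro f hf c hc he
  have key : ∑ a, pderiv a (pderiv a f) = 0 → f = 0 := by
    intro h0
    rw [h0, mul_zero, eq_comm, neg_eq_zero, mul_eq_zero] at he
    rcases he with h | h
    · exact absurd (C_eq_zero.mp h) hc.ne'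
    · exact h
  apply key
  rcases k with _ | _ | k
  · simp [pderiv_hom0 hf]
  · refine Finset.sum_eq_zero fun a _ => ?_
    exact pderiv_hom0 hf.pderiv a
  · set g := ∑ a, pderiv a (pderiv a f) with hg
    have hgh : g.IsHomogeneous k := by
      refine IsHomogeneous.sum _ _ _ fun a _ => ?_
      exact (hf.pderiv (i := a)).pderiv
    refine ih k (by omega) g hgh (c + 2 * Fintype.card ι + 4 * k) (by positivity) ?_
    have h1 := lap_r2 hgh
    rw [he] at h1
    simp only [map_neg, pderiv_C_mul, Finset.sum_neg_distrib, ← Finset.mul_sum] at h1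
    rw [← hg] at h1
    simp only [map_add, map_mul, map_natCast]
    have h2 : (C 2 : MvPolynomial ι ℝ) = 2 := map_ofNat C 2
    have h4 : (C 4 : MvPolynomial ι ℝ) = 4 := map_ofNat C 4
    rw [h2, h4]
    linear_combination -h1

lemma contract {k : ℕ} {h P : ι → ι → MvPolynomial ι ℝ}
    (hsym : ∀ a b, h a b = h b a) (hx : ∀ a, ∑ b, h a b * X b = 0)
    (hh : ∀ a b, (h a b).IsHomogeneous k) (hP : ∀ a b, P a b = P b a)
    (he : ∀ a b c d, Rl h a b c d + KN P a b c d = 0) (b d : ι) :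
    (k : MvPolynomial ι ℝ) * ((k : MvPolynomial ι ℝ) + 1) * h b d + ((∑ c, X c * X c) * P b d
      - X d * (∑ c, X c * P b c) - X b * (∑ c, X c * P d c)
      + dl b d * ∑ a, X a * ∑ c, X c * P a c) = 0 := by
  have L1 : ∀ a b d, ∑ c, X c * pderiv a (pderiv c (h b d)) =
      ((k : MvPolynomial ι ℝ) - 1) * pderiv a (h b d) := by
    intro a b d
    have h1 := congrArg (pderiv a) (euler' (hh b d))
    simp only [map_sum, pderiv_mul, pderiv_X', Finset.sum_add_distrib, sum_dl_mul,
      Derivation.map_natCast] at h1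
    linear_combination h1
  have L2 : ∀ b d, ∑ c, X c * pderiv d (h b c) = - h b d := by
    intro b d
    have h1 := congrArg (pderiv d) (hx b)
    simp only [map_sum, pderiv_mul, pderiv_X', Finset.sum_add_distrib, map_zero] at h1
    simp only [mul_comm _ (dl _ _), sum_dl_mul, mul_comm _ (X _)] at h1
    linear_combination h1
  have L3 : ∀ a b d, ∑ c, X c * pderiv a (pderiv d (h b c)) =
      - pderiv a (h b d) - pderiv d (h b a) := by
    intro a b d
    have h1 := congrArg (pderiv a) (L2 b d)
    simp only [map_sum, pderiv_mul, pderiv_X', Finset.sum_add_distrib, map_neg, sum_dl_mul] at h1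
    linear_combination h1
  have T1 : ∑ a, X a * ∑ c, X c * pderiv a (pderiv c (h b d)) =
      ((k : MvPolynomial ι ℝ) - 1) * ((k : MvPolynomial ι ℝ) * h b d) := by
    simp only [L1]
    rw [← euler' (hh b d), Finset.mul_sum]
    exact Finset.sum_congr rfl fun a _ => by ring
  have T2 : ∑ a, X a * ∑ c, X c * pderiv a (pderiv d (h b c)) =
      - ((k : MvPolynomial ι ℝ) * h b d) + h b d := by
    simp only [L3, mul_sub, mul_neg, Finset.sum_sub_distrib, Finset.sum_neg_distrib, L2,
      euler' (hh b d)]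
    ring
  have T3 : ∑ a, X a * ∑ c, X c * pderiv b (pderiv c (h a d)) =
      - ((k : MvPolynomial ι ℝ) * h b d) + h b d := by
    simp only [L1]
    have e1 : ∀ a, h a d = h d a := fun a => hsym a d
    rw [Finset.sum_congr rfl fun a _ => by rw [e1 a]]
    have : ∀ a, X a * (((k : MvPolynomial ι ℝ) - 1) * pderiv b (h d a)) =
      ((k : MvPolynomial ι ℝ) - 1) * (X a * pderiv b (h d a)) := fun a => by ring
    simp only [this, ← Finset.mul_sum, L2]
    rw [hsym d b]
    ring
  have T4 : ∑ a, X a * ∑ c, X c * pderiv b (pderiv d (h a c)) = 2 * h b d := by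
    simp only [L3, mul_sub, mul_neg, Finset.sum_sub_distrib, Finset.sum_neg_distrib]
    have e1 : ∑ a, X a * pderiv b (h a d) = ∑ a, X a * pderiv b (h d a) :=
      Finset.sum_congr rfl fun a _ => by rw [hsym]
    have e2 : ∑ a, X a * pderiv d (h a b) = ∑ a, X a * pderiv d (h b a) :=
      Finset.sum_congr rfl fun a _ => by rw [hsym]
    rw [e1, e2, L2, L2, hsym d b]
    ring
  have K1 : ∑ a, X a * ∑ c, X c * (P b d * dl a c) = (∑ c, X c * X c) * P b d := by
    have : ∀ a c, X c * (P b d * dl a c) = dl a c * (X c * P b d) := fun a c => by ring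
    simp only [this, sum_dl_mul, Finset.sum_mul, mul_assoc]
  have K2 : ∑ a, X a * ∑ c, X c * (P b c * dl a d) = X d * (∑ c, X c * P b c) := by
    have : ∀ a, X a * ∑ c, X c * (P b c * dl a d) = dl d a * (X a * ∑ c, X c * P b c) := by
      intro a
      have e : (dl d a : MvPolynomial ι ℝ) = dl a d := by simp [dl, eq_comm]
      simp only [Finset.mul_sum, e]
      exact Finset.sum_congr rfl fun _ _ => by ring
    simp only [this, sum_dl_mul]
  have K3 : ∑ a, X a * ∑ c, X c * (P a d * dl b c) = X b * (∑ c, X c * P d c) := by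
    have : ∀ a c, X c * (P a d * dl b c) = dl b c * (X c * P a d) := fun a c => by ring
    simp only [this, sum_dl_mul, Finset.mul_sum]
    exact Finset.sum_congr rfl fun a _ => by rw [hP d a]; ring
  have K4 : ∑ a, X a * ∑ c, X c * (P a c * dl b d) = dl b d * ∑ a, X a * ∑ c, X c * P a c := by
    simp only [Finset.mul_sum]
    exact Finset.sum_congr rfl fun _ _ => Finset.sum_congr rfl fun _ _ => by ring
  have tot : ∑ a, X a * ∑ c, X c * (Rl h a b c d + KN P a b c d) = 0 := by
    simp [he]
  simp only [Rl, KN, mul_add, mul_sub, Finset.sum_add_distrib, Finset.sum_sub_distrib] at tot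
  rw [T1, T2, T3, T4, K1, K2, K3, K4] at tot
  linear_combination tot

/-- Bianchi identity: the tensor P is Codazzi. -/
lemma cotton (hN : 4 ≤ Fintype.card ι) {h P : ι → ι → MvPolynomial ι ℝ}
    (hP : ∀ a b, P a b = P b a)
    (he : ∀ a b c d, Rl h a b c d + KN P a b c d = 0) (e b d : ι) :
    pderiv e (P b d) = pderiv b (P e d) := by
  have bian : ∀ e a b c d, pderiv e (KN P a b c d) + pderiv a (KN P b e c d)
      + pderiv b (KN P e a c d) = 0 := by
    intro e a b c d
    have hk : ∀ a b c d, KN P a b c d = - Rl h a b c d := fun a b c d => by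
      linear_combination he a b c d
    simp only [hk, Rl, map_neg, map_add, map_sub]
    rw [pderiv_comm' a e, pderiv_comm' b e, pderiv_comm' a e, pderiv_comm' b e, pderiv_comm' b a,
      pderiv_comm' b a]
    ring
  have dd : ∀ (e a b : ι) , pderiv e (dl a b : MvPolynomial ι ℝ) = 0 := by
    intro e a b; unfold dl; split_ifs <;> simp
  have main : ∀ e b d a : ι, a ≠ e → a ≠ b → a ≠ d →
      (pderiv e (P b d) - pderiv b (P e d)) + dl b d * (pderiv e (P a a) - pderiv a (P e a))
       - dl e d * (pderiv b (P a a) - pderiv a (P b a)) = 0 := by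
    intro e b d a h1 h2 h3
    have h := bian e a b a d
    have z1 : (dl a d : MvPolynomial ι ℝ) = 0 := by simp [dl, h3]
    have z2 : (dl b a : MvPolynomial ι ℝ) = 0 := by simp [dl, h2.symm]
    have z3 : (dl e a : MvPolynomial ι ℝ) = 0 := by simp [dl, h1.symm]
    have z4 : (dl a a : MvPolynomial ι ℝ) = 1 := by simp [dl]
    simp only [KN, map_add, map_sub, pderiv_mul, dd, z1, z2, z3, z4, map_zero, pderiv_one] at h
    linear_combination h
  by_cases heb : e = b
  · subst heb; rfl
  have ex : ∀ s : Finset ι, s.card < 4 → ∃ a, a ∉ s := by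
    intro s hs
    by_contra hc
    push Not at hc
    have := Finset.eq_univ_of_forall hc
    rw [this, Finset.card_univ] at hs
    omega
  have diag : ∀ e b : ι, e ≠ b → pderiv e (P b b) - pderiv b (P e b) = 0 := by
    intro e b heb
    obtain ⟨a, ha⟩ := ex {e, b} (by have := Finset.card_le_two (a := e) (b := b); omega)
    obtain ⟨a', ha'⟩ := ex {e, b, a} (by have := Finset.card_le_three (a := e) (b := b) (c := a); omega)
    simp only [Finset.mem_insert, Finset.mem_singleton, not_or] at ha ha'
    have m1 := main e b b a ha.1 ha.2 ha.2
    have m2 := main e b b a' ha'.1 ha'.2.1 ha'.2.1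
    have m3 := main e a a a' ha'.1 ha'.2.2 ha'.2.2
    simp only [dl, if_true, heb, if_false, if_neg (Ne.symm ha.1)] at m1 m2 m3
    have : (2 : MvPolynomial ι ℝ) * (pderiv e (P b b) - pderiv b (P e b)) = 0 := by
      linear_combination m1 + m2 - m3
    simpa using this
  by_cases hbd : b = d
  · subst hbd; exact sub_eq_zero.mp (diag e b heb)
  by_cases hed : e = d
  · subst hed
    rw [hP b e, ← sub_eq_zero, ← neg_eq_zero, neg_sub]
    rw [hP e b]
    have := diag b e (Ne.symm heb)
    rwa [hP b e, hP e b] at this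
  obtain ⟨a, ha⟩ := ex {e, b, d} (by have := Finset.card_le_three (a := e) (b := b) (c := d); omega)
  simp only [Finset.mem_insert, Finset.mem_singleton, not_or] at ha
  have m := main e b d a ha.1 ha.2.1 ha.2.2
  simp only [dl, hbd, hed, if_false] at m
  linear_combination m

lemma P_zero {m : ℕ} (hN : 4 ≤ Fintype.card ι) {h P : ι → ι → MvPolynomial ι ℝ}
    (hsym : ∀ a b, h a b = h b a) (hx : ∀ a, ∑ b, h a b * X b = 0) (htr : ∑ a, h a a = 0)
    (hh : ∀ a b, (h a b).IsHomogeneous (m + 2)) (hP : ∀ a b, P a b = P b a)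
    (hPh : ∀ a b, (P a b).IsHomogeneous m)
    (he : ∀ a b c d, Rl h a b c d + KN P a b c d = 0) (b d : ι) : P b d = 0 := by
  have hct := contract hsym hx hh hP he
  have cot := cotton hN hP he
  set v : ι → MvPolynomial ι ℝ := fun b => ∑ c, X c * P b c with hv
  set s : MvPolynomial ι ℝ := ∑ a, X a * v a with hs
  have dv : ∀ d e, pderiv d (v e) = ((m : MvPolynomial ι ℝ) + 1) * P d e := by
    intro d e
    have : ∀ c, pderiv d (P e c) = pderiv c (P d e) := fun c => by
      rw [hP e c, cot, ]
    simp only [hv, map_sum, pderiv_mul, pderiv_X', Finset.sum_add_distrib, sum_dl_mul, this,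
      euler' (hPh _ _)]
    rw [hP e d]; ring
  have ds : ∀ e, pderiv e s = ((m : MvPolynomial ι ℝ) + 2) * v e := by
    intro e
    simp only [hs, map_sum, pderiv_mul, pderiv_X', Finset.sum_add_distrib, sum_dl_mul, dv]
    have : ∀ c, X c * (((m : MvPolynomial ι ℝ) + 1) * P e c) =
      ((m : MvPolynomial ι ℝ) + 1) * (X c * P e c) := fun a => by ring
    simp only [this, ← Finset.mul_sum]
    simp only [hv]
    ring
  have dnat : ∀ (a : ι) (p : MvPolynomial ι ℝ), pderiv a (((m : MvPolynomial ι ℝ) + 2) * p) =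
      ((m : MvPolynomial ι ℝ) + 2) * pderiv a p := by
    intro a p
    have : ((m : MvPolynomial ι ℝ) + 2) = C ((m : ℝ) + 2) := by simp only [map_add, map_natCast, map_ofNat]
    rw [this, pderiv_C_mul]
  have dds : ∀ d e, pderiv d (pderiv e s) =
      ((m : MvPolynomial ι ℝ) + 2) * (((m : MvPolynomial ι ℝ) + 1) * P d e) := by
    intro d e
    rw [ds, dnat, dv]
  have tr : (∑ c, X c * X c) * (∑ a, P a a) = - (((Fintype.card ι : MvPolynomial ι ℝ) - 2) * s) := by
    have h1 : ∑ b, (((m+2 : ℕ) : MvPolynomial ι ℝ) * (((m+2 : ℕ) : MvPolynomial ι ℝ) + 1) * h b b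
      + ((∑ c, X c * X c) * P b b
      - X b * v b - X b * v b + dl b b * s)) = 0 :=
      Finset.sum_eq_zero fun b _ => hct b b
    simp only [Finset.sum_add_distrib, Finset.sum_sub_distrib, ← Finset.mul_sum, htr] at h1
    rw [← hs] at h1
    simp [dl] at h1
    linear_combination h1
  have s0 : s = 0 := by
    refine lap_zero (m + 2) s ?_ (((Fintype.card ι : ℝ) - 2) * ((m + 2) * (m + 1))) ?_ ?_
    · refine IsHomogeneous.sum _ _ _ fun a _ => ?_
      have hva : (v a).IsHomogeneous (1 + m) := IsHomogeneous.sum _ _ _ fun c _ =>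
        (isHomogeneous_X ℝ c).mul (hPh a c)
      have := (isHomogeneous_X ℝ a).mul hva
      convert this using 1; omega
    · have : (4 : ℝ) ≤ Fintype.card ι := by exact_mod_cast hN
      have : (0 : ℝ) < Fintype.card ι - 2 := by linarith
      positivity
    · simp only [dds, ← Finset.mul_sum]
      simp only [map_mul, map_sub, map_add, map_natCast, map_one, map_ofNat]
      linear_combination ((m : MvPolynomial ι ℝ) + 2) * (((m : MvPolynomial ι ℝ) + 1)) * tr
  have h1 := dds b d
  rw [s0, map_zero, map_zero] at h1
  have e : ((m : MvPolynomial ι ℝ) + 2) * (((m : MvPolynomial ι ℝ) + 1) * P b d) =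
    C (((m : ℝ) + 2) * (m + 1)) * P b d := by
    simp only [map_add, map_mul, map_natCast, map_ofNat, map_one]; ring
  rw [e, eq_comm, mul_eq_zero] at h1
  rcases h1 with h1 | h1
  · exact absurd (C_eq_zero.mp h1) (by positivity)
  · exact h1

lemma h_zero_of_P {k : ℕ} {h : ι → ι → MvPolynomial ι ℝ}
    (hsym : ∀ a b, h a b = h b a) (hx : ∀ a, ∑ b, h a b * X b = 0)
    (hh : ∀ a b, (h a b).IsHomogeneous (k + 1))
    (he : ∀ a b c d, Rl h a b c d = 0) (b d : ι) : h b d = 0 := by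
  have := contract (P := fun _ _ => 0) hsym hx hh (fun _ _ => rfl)
    (fun a b c d => by simp [he, KN]) b d
  simp only [mul_zero, Finset.sum_const_zero, sub_zero, add_zero] at this
  have e : ((k + 1 : ℕ) : MvPolynomial ι ℝ) * (((k + 1 : ℕ) : MvPolynomial ι ℝ) + 1) * h b d =
    C (((k : ℝ) + 1) * (k + 1 + 1)) * h b d := by simp
  rw [e, mul_eq_zero] at this
  rcases this with h1 | h1
  · exact absurd (C_eq_zero.mp h1) (by positivity)
  · exact h1

lemma hc_pderiv (k : ℕ) (a : ι) (p : MvPolynomial ι ℝ) :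
    homogeneousComponent k (pderiv a p) = pderiv a (homogeneousComponent (k + 1) p) := by
  ext m
  simp only [coeff_homogeneousComponent, coeff_pderiv, map_add, Finsupp.degree_single]
  by_cases hm : m.degree = k <;> simp [hm]

lemma hc_mul_X (k : ℕ) (a : ι) (p : MvPolynomial ι ℝ) :
    homogeneousComponent (k + 1) (p * X a) = homogeneousComponent k p * X a := by
  ext m
  simp only [coeff_homogeneousComponent, coeff_mul_X']
  by_cases ha : a ∈ m.support
  · simp only [ha, if_true]
    have : m = (m - Finsupp.single a 1) + Finsupp.single a 1 := by
      rw [tsub_add_cancel_of_le]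
      simpa [Nat.one_le_iff_ne_zero] using ha
    have h2 : m.degree = (m - Finsupp.single a 1).degree + 1 := by
      conv_lhs => rw [this]
      simp
    rw [h2]; simp
  · simp [ha]

theorem flat_zero (hN : 4 ≤ Fintype.card ι) {h P : ι → ι → MvPolynomial ι ℝ}
    (hsym : ∀ a b, h a b = h b a) (hx : ∀ a, ∑ b, h a b * X b = 0) (htr : ∑ a, h a a = 0)
    (hP : ∀ a b, P a b = P b a)
    (he : ∀ a b c d, Rl h a b c d + KN P a b c d = 0) (a b : ι) : h a b = 0 := by
  suffices hk : ∀ k, ∀ a b, homogeneousComponent k (h a b) = 0 by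
    rw [← sum_homogeneousComponent (h a b)]
    exact Finset.sum_eq_zero fun k _ => hk k a b
  intro k
  have hsymk : ∀ a b, homogeneousComponent k (h a b) = homogeneousComponent k (h b a) :=
    fun a b => by rw [hsym]
  have hxk : ∀ a, ∑ b, homogeneousComponent k (h a b) * X b = 0 := by
    intro a
    simp only [← hc_mul_X, ← map_sum, hx, map_zero]
  have htrk : ∑ a, homogeneousComponent k (h a a) = 0 := by
    rw [← map_sum, htr, map_zero]
  have hhk : ∀ a b, (homogeneousComponent k (h a b)).IsHomogeneous k :=
    fun a b => homogeneousComponent_isHomogeneous _ _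
  rcases k with _ | _ | k
  · intro a b
    have h1 := congrArg (pderiv b) (hxk a)
    simp only [map_sum, pderiv_mul, pderiv_X', pderiv_hom0 (hhk _ _), zero_mul, zero_add,
      map_zero] at h1
    simp only [mul_comm _ (dl _ _), sum_dl_mul] at h1
    exact h1
  · refine h_zero_of_P hsymk hxk hhk ?_
    intro a b c d
    simp [Rl, pderiv_hom0 (hhk _ _).pderiv]
  · have hek : ∀ a b c d, Rl (fun a b => homogeneousComponent (k+2) (h a b)) a b c d
        + KN (fun a b => homogeneousComponent k (P a b)) a b c d = 0 := by
      intro a b c d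
      have h1 := congrArg (homogeneousComponent k) (he a b c d)
      have h2 : ∀ (p : MvPolynomial ι ℝ) (a b : ι), homogeneousComponent k (p * dl a b) =
          homogeneousComponent k p * dl a b := by
        intro p a b; unfold dl; split_ifs <;> simp
      simpa only [Rl, KN, map_add, map_sub, map_zero, h2, hc_pderiv] using h1
    have hP0 := P_zero hN hsymk hxk htrk hhk (fun a b => by rw [hP])
      (fun a b => homogeneousComponent_isHomogeneous _ _) hek
    refine h_zero_of_P hsymk hxk hhk ?_
    intro a b c d
    have := hek a b c d
    simpa [KN, hP0] using this

end PartOne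

section PartTwo
open MvPolynomial
set_option linter.all false

variable {n : ℕ}

def Ap (Q : Fin n → Fin n → MvPolynomial (Fin n) ℝ) (i k : Fin n) : MvPolynomial (Fin n) ℝ :=
  (∑ m, pderiv i (pderiv m (Q m k))) + (∑ m, pderiv m (pderiv k (Q i m)))
      - (∑ m, pderiv m (pderiv m (Q i k)))
      - C (1 / ((n : ℝ) - 1)) * (∑ m, ∑ p, pderiv m (pderiv p (Q m p))) * dl i k

def Zp (Q : Fin n → Fin n → MvPolynomial (Fin n) ℝ) (i j k l : Fin n) : MvPolynomial (Fin n) ℝ :=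
  Rl Q i j k l + C (1 / ((n : ℝ) - 2)) * KN (Ap Q) i j k l

lemma Ap_symm {Q : Fin n → Fin n → MvPolynomial (Fin n) ℝ} (hs : ∀ i k, Q i k = Q k i)
    (i k : Fin n) : Ap Q i k = Ap Q k i := by
  have e1 : ∑ m, pderiv i (pderiv m (Q m k)) = ∑ m, pderiv m (pderiv i (Q k m)) :=
    Finset.sum_congr rfl fun m _ => by rw [pderiv_comm', hs]
  have e2 : ∑ m, pderiv m (pderiv k (Q i m)) = ∑ m, pderiv k (pderiv m (Q m i)) :=
    Finset.sum_congr rfl fun m _ => by rw [pderiv_comm', hs]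
  have e3 : (dl i k : MvPolynomial (Fin n) ℝ) = dl k i := by simp [dl, eq_comm]
  rw [Ap, Ap, e1, e2, e3, hs i k]
  ring

abbrev Tn {n : ℕ} (l₀ : Fin n) : Type := {i : Fin n // i ≠ l₀}

def kap (l₀ : Fin n) : MvPolynomial (Fin n) ℝ →ₐ[ℝ] MvPolynomial (Tn l₀) ℝ :=
  killCompl (Subtype.val_injective (p := fun i : Fin n => i ≠ l₀))

lemma kap_X (l₀ : Fin n) (a : Tn l₀) : kap l₀ (X a.1) = X a := by
  have := killCompl_rename_app (R := ℝ) (Subtype.val_injective (p := fun i : Fin n => i ≠ l₀)) (X a)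
  rwa [rename_X] at this

lemma kap_X0 (l₀ : Fin n) : kap l₀ (X l₀) = 0 := by
  simp [kap, killCompl]

lemma kap_pderiv (l₀ : Fin n) (a : Tn l₀) (p : MvPolynomial (Fin n) ℝ) :
    kap l₀ (pderiv a.1 p) = pderiv a (kap l₀ p) := by
  ext m
  simp only [kap, coeff_killCompl, coeff_pderiv, Finsupp.mapDomain_add, Finsupp.mapDomain_single]
  rw [Finsupp.mapDomain_apply Subtype.val_injective]

lemma kap_coeff (l₀ : Fin n) {p : MvPolynomial (Fin n) ℝ} (hp : kap l₀ p = 0)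
    (m : Fin n →₀ ℕ) (hm : m l₀ = 0) : coeff m p = 0 := by
  have h1 := coeff_killCompl (p := p) (Subtype.val_injective (p := fun i : Fin n => i ≠ l₀))
    (s := m.comapDomain Subtype.val Subtype.val_injective.injOn)
  rw [Finsupp.mapDomain_comapDomain _ Subtype.val_injective] at h1
  · rw [← h1]
    show coeff _ (kap l₀ p) = 0
    rw [hp, coeff_zero]
  · intro i hi
    simp only [Subtype.range_coe_subtype, Set.mem_setOf_eq]
    rintro rfl
    simp [hm] at hi

lemma kap_eval (l₀ : Fin n) (p : MvPolynomial (Fin n) ℝ) (y : Tn l₀ → ℝ) :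
    eval y (kap l₀ p) = eval (fun i => if h : i ≠ l₀ then y ⟨i, h⟩ else 0) p := by
  induction p using MvPolynomial.induction_on with
  | C a => simp [kap, killCompl_C]
  | add p q hp hq => simp only [map_add, hp, hq]
  | mul_X p i hp =>
    rw [map_mul, map_mul, map_mul, hp]
    congr 1
    by_cases h : i = l₀
    · subst h; simp [kap_X0]
    · rw [show X i = X (⟨i, h⟩ : Tn l₀).1 from rfl, kap_X]; simp [h]

def VV (l₀ : Fin n) (j : ℕ) (p : MvPolynomial (Fin n) ℝ) : Prop :=
  ∀ m : Fin n →₀ ℕ, m l₀ = j → coeff m p = 0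

lemma VV.zero {l₀ : Fin n} {j : ℕ} : VV l₀ j 0 := fun m _ => coeff_zero m

lemma VV.add {l₀ : Fin n} {j : ℕ} {p q : MvPolynomial (Fin n) ℝ} (hp : VV l₀ j p)
    (hq : VV l₀ j q) : VV l₀ j (p + q) := fun m hm => by
  rw [coeff_add, hp m hm, hq m hm, add_zero]

lemma VV.sub {l₀ : Fin n} {j : ℕ} {p q : MvPolynomial (Fin n) ℝ} (hp : VV l₀ j p)
    (hq : VV l₀ j q) : VV l₀ j (p - q) := fun m hm => by
  rw [coeff_sub, hp m hm, hq m hm, sub_zero]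

lemma VV.cmul {l₀ : Fin n} {j : ℕ} {p : MvPolynomial (Fin n) ℝ} (c : ℝ) (hp : VV l₀ j p) :
    VV l₀ j (C c * p) := fun m hm => by
  rw [coeff_C_mul, hp m hm, mul_zero]

lemma VV.dmul {l₀ : Fin n} {j : ℕ} {p : MvPolynomial (Fin n) ℝ} (a b : Fin n) (hp : VV l₀ j p) :
    VV l₀ j (p * dl a b) := by
  unfold dl; split_ifs
  · simpa using hp
  · simpa using VV.zero

lemma VV.sum {l₀ : Fin n} {j : ℕ} {f : Fin n → MvPolynomial (Fin n) ℝ}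
    (hp : ∀ i, VV l₀ j (f i)) : VV l₀ j (∑ i, f i) := fun m hm => by
  rw [coeff_sum]; exact Finset.sum_eq_zero fun i _ => hp i m hm

lemma VV.pd {l₀ : Fin n} {j : ℕ} {p : MvPolynomial (Fin n) ℝ} (a : Fin n) (ha : a ≠ l₀)
    (hp : VV l₀ j p) : VV l₀ j (pderiv a p) := fun m hm => by
  rw [coeff_pderiv, hp _ (by simp [hm, ha]), zero_mul]

theorem poly_main (hn : 6 ≤ n) (l₀ : Fin n) {Q : Fin n → Fin n → MvPolynomial (Fin n) ℝ}
    (hs : ∀ i k, Q i k = Q k i) (htr : ∑ i, Q i i = 0) (hl : ∀ i, Q i l₀ = 0)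
    (hx : ∀ i, kap l₀ (∑ k, Q i k * X k) = 0)
    (hD : ∀ i k, kap l₀ (pderiv l₀ (Q i k)) = 0)
    (hZ : ∀ i j k l, Zp Q i j k l = 0) (i k : Fin n) : Q i k = 0 := by
  have hl' : ∀ i, Q l₀ i = 0 := fun i => by rw [hs, hl]
  have split : ∀ {M : Type} [AddCommMonoid M] (f : Fin n → M),
      ∑ k, f k = f l₀ + ∑ a : Tn l₀, f a.1 := fun f => Fintype.sum_eq_add_sum_subtype_ne f l₀
  have card : Fintype.card (Tn l₀) = n - 1 := by
    simp [Tn, Fintype.card_subtype_compl]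
  have kdl : ∀ a b : Tn l₀, kap l₀ (dl a.1 b.1) = dl a b := by
    intro a b
    simp only [dl, Subtype.ext_iff]
    split_ifs <;> simp
  have base : ∀ a b : Tn l₀, kap l₀ (Q a.1 b.1) = 0 := by
    refine flat_zero (h := fun a b => kap l₀ (Q a.1 b.1))
      (P := fun a b => kap l₀ (C (1 / ((n : ℝ) - 2)) * Ap Q a.1 b.1)) (by omega) ?_ ?_ ?_ ?_ ?_
    · intro a b; simp only [hs a.1 b.1]
    · intro a
      have h1 := hx a.1
      rw [split, hl, zero_mul, zero_add, map_sum] at h1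
      simpa only [map_mul, kap_X] using h1
    · have h1 := congrArg (kap l₀) htr
      rw [split, hl, zero_add, map_sum, map_zero] at h1
      exact h1
    · intro a b; simp only [Ap_symm hs a.1 b.1]
    · intro a b c d
      have h1 := congrArg (kap l₀) (hZ a.1 b.1 c.1 d.1)
      simp only [Zp, Rl, KN, map_add, map_sub, map_mul, kap_pderiv, kdl, map_zero] at h1
      simp only [Rl, KN, map_mul]
      linear_combination h1
  have base' : ∀ i k, kap l₀ (Q i k) = 0 := by
    intro i k
    by_cases hi : i = l₀
    · rw [hi, hl', map_zero]
    by_cases hk : k = l₀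
    · rw [hk, hl, map_zero]
    exact base ⟨i, hi⟩ ⟨k, hk⟩
  have all : ∀ j, ∀ i k, VV l₀ j (Q i k) := by
    intro j
    induction j using Nat.strong_induction_on with
    | _ j ih =>
    rcases j with _ | _ | j
    · exact fun i k m hm => kap_coeff l₀ (base' i k) m hm
    · intro i k m hm
      have h1 := kap_coeff l₀ (hD i k) (m - Finsupp.single l₀ 1) (by simp [hm])
      rw [coeff_pderiv, tsub_add_cancel_of_le (by simp [hm])] at h1
      simpa [hm] using h1
    · intro a b
      have ihj := ih j (by omega)
      by_cases ha : a = l₀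
      · rw [ha, hl']; exact VV.zero
      by_cases hb : b = l₀
      · rw [hb, hl]; exact VV.zero
      have hQ2 : ∀ p q : Fin n, ∀ r s : Fin n, (r = l₀ ∨ s = l₀ ∨ (p ≠ l₀ ∧ q ≠ l₀)) →
          VV l₀ j (pderiv p (pderiv q (Q r s))) := by
        rintro p q r s (h | h | ⟨h, h'⟩)
        · rw [h, hl', map_zero, map_zero]; exact VV.zero
        · rw [h, hl, map_zero, map_zero]; exact VV.zero
        · exact ((ihj r s).pd q h').pd p h
      have dbl : VV l₀ j (∑ m, ∑ p, pderiv m (pderiv p (Q m p))) :=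
        VV.sum fun m => VV.sum fun p => hQ2 _ _ _ _ (by tauto)
      have A1 : VV l₀ j (Ap Q a b + pderiv l₀ (pderiv l₀ (Q a b))) := by
        have e : ∑ m, pderiv m (pderiv m (Q a b)) = pderiv l₀ (pderiv l₀ (Q a b))
            + ∑ m, if m = l₀ then 0 else pderiv m (pderiv m (Q a b)) := by
          rw [split, split (fun m => if m = l₀ then 0 else pderiv m (pderiv m (Q a b)))]
          simp only [if_true, zero_add]
          congr 1
          exact Finset.sum_congr rfl fun m _ => by rw [if_neg m.2]
        have e2 : Ap Q a b + pderiv l₀ (pderiv l₀ (Q a b)) =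
          (∑ m, pderiv a (pderiv m (Q m b))) + (∑ m, pderiv m (pderiv b (Q a m)))
            - (∑ m, if m = l₀ then 0 else pderiv m (pderiv m (Q a b)))
            - C (1 / ((n : ℝ) - 1)) * (∑ m, ∑ p, pderiv m (pderiv p (Q m p))) * dl a b := by
          rw [Ap, e]; ring
        rw [e2]
        refine VV.sub (VV.sub (VV.add (VV.sum fun m => ?_) (VV.sum fun m => ?_))
          (VV.sum fun m => ?_)) (VV.dmul _ _ (VV.cmul _ dbl))
        · exact hQ2 _ _ _ _ (by tauto)
        · exact hQ2 _ _ _ _ (by tauto)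
        · split_ifs with h
          · exact VV.zero
          · exact hQ2 _ _ _ _ (by tauto)
      have A2 : VV l₀ j (Ap Q l₀ l₀) := by
        refine VV.sub (VV.sub (VV.add (VV.sum fun m => ?_) (VV.sum fun m => ?_))
          (VV.sum fun m => ?_)) (VV.dmul _ _ (VV.cmul _ dbl)) <;>
        exact hQ2 _ _ _ _ (by tauto)
      have z := hZ l₀ a l₀ b
      have d1 : (dl l₀ l₀ : MvPolynomial (Fin n) ℝ) = 1 := by simp [dl]
      have d2 : (dl l₀ b : MvPolynomial (Fin n) ℝ) = 0 := by simp [dl, Ne.symm hb]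
      have d3 : (dl a l₀ : MvPolynomial (Fin n) ℝ) = 0 := by simp [dl, ha]
      simp only [Zp, Rl, KN, hl, hl', d1, d2, d3, map_zero] at z
      have W := ((A1.add (A2.dmul a b)).cmul (1 / ((n : ℝ) - 2)))
      intro m hm
      have hw := W (m - Finsupp.single l₀ 1 - Finsupp.single l₀ 1) (by simp [hm])
      set t := coeff (m - Finsupp.single l₀ 1 - Finsupp.single l₀ 1)
        (pderiv l₀ (pderiv l₀ (Q a b))) with ht
      have hz : pderiv l₀ (pderiv l₀ (Q a b)) =
          C (1 / ((n : ℝ) - 2)) * pderiv l₀ (pderiv l₀ (Q a b)) -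
          C (1 / ((n : ℝ) - 2)) * (Ap Q a b + pderiv l₀ (pderiv l₀ (Q a b)) +
            Ap Q l₀ l₀ * dl a b) := by
        linear_combination z
      have hz' := congrArg (coeff (m - Finsupp.single l₀ 1 - Finsupp.single l₀ 1)) hz
      rw [coeff_sub, hw, coeff_C_mul, ← ht, sub_zero] at hz'
      have hnR : (6 : ℝ) ≤ n := by exact_mod_cast hn
      have ht0 : t = 0 := by
        have h2 : (n : ℝ) - 2 ≠ 0 := by linarith
        field_simp at hz'
        have : t * ((n : ℝ) - 3) = 0 := by linarith
        rcases mul_eq_zero.mp this with h | h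
        · exact h
        · linarith
      rw [ht0, coeff_pderiv, coeff_pderiv, tsub_add_cancel_of_le, tsub_add_cancel_of_le] at ht
      · have := ht.symm
        rcases mul_eq_zero.mp this with h | h
        · rcases mul_eq_zero.mp h with h | h
          · exact h
          · exfalso; revert h; positivity
        · exfalso; revert h; positivity
      · simp [hm]
      · simp [hm]
  ext m
  rw [all (m l₀) i k m rfl, coeff_zero]

lemma pd_eval (p : MvPolynomial (Fin n) ℝ) (x : Euc n) :
    ∃ L : Euc n →L[ℝ] ℝ, HasFDerivAt (fun x : Euc n => eval (fun m => x m) p) L x ∧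
      ∀ i, L (EuclideanSpace.single i 1) = eval (fun m => x m) (pderiv i p) := by
  induction p using MvPolynomial.induction_on with
  | C a =>
    refine ⟨0, ?_, fun i => by simp⟩
    simpa using hasFDerivAt_const a x
  | add p q hp hq =>
    obtain ⟨L, h1, h2⟩ := hp
    obtain ⟨L', h1', h2'⟩ := hq
    refine ⟨L + L', ?_, fun i => by simp [h2, h2']⟩
    have e : (fun x : Euc n => eval (fun m => x m) (p + q)) =
        (fun x : Euc n => eval (fun m => x m) p) + fun x : Euc n => eval (fun m => x m) q := by
      funext x; simp
    rw [e]
    exact h1.add h1'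
  | mul_X p j hp =>
    obtain ⟨L, h1, h2⟩ := hp
    have h3 : HasFDerivAt (fun x : Euc n => x j) (EuclideanSpace.proj j : Euc n →L[ℝ] ℝ) x :=
      (EuclideanSpace.proj j : Euc n →L[ℝ] ℝ).hasFDerivAt
    have e : (fun x : Euc n => eval (fun m => x m) (p * X j)) =
        (fun x : Euc n => eval (fun m => x m) p) * fun x : Euc n => x j := by
      funext x; simp
    rw [e]
    refine ⟨_, h1.mul h3, fun i => ?_⟩
    simp only [ContinuousLinearMap.add_apply, ContinuousLinearMap.smul_apply, h2, pderiv_mul,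
      pderiv_X', map_add, map_mul, eval_X, smul_eq_mul]
    have : (EuclideanSpace.proj j : Euc n →L[ℝ] ℝ) (EuclideanSpace.single i (1:ℝ)) = eval (fun m => x m) (dl i j) := by
      unfold dl
      by_cases h : i = j
      · simp [h]
      · simp [h, Ne.symm h]
    rw [this]; ring

lemma pd_eval' (p : MvPolynomial (Fin n) ℝ) (i : Fin n) :
    pd i (fun x : Euc n => eval (fun m => x m) p) =
      fun x : Euc n => eval (fun m => x m) (pderiv i p) := by
  funext x
  obtain ⟨L, h1, h2⟩ := pd_eval p x
  rw [pd, h1.fderiv, h2]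

lemma half_zero (l₀ : Fin n) (p : MvPolynomial (Fin n) ℝ)
    (hp : ∀ x : Euc n, 0 ≤ x l₀ → eval (fun m => x m) p = 0) : p = 0 := by
  refine MvPolynomial.funext_set (fun _ => Set.Ici (0:ℝ)) (fun _ => Set.Ici_infinite 0) ?_
  intro x hx
  rw [map_zero]
  exact hp (WithLp.toLp 2 x) (hx l₀ (Set.mem_univ _))

lemma kap_zero (l₀ : Fin n) (p : MvPolynomial (Fin n) ℝ)
    (hp : ∀ x : Euc n, x l₀ = 0 → eval (fun m => x m) p = 0) : kap l₀ p = 0 := by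
  refine MvPolynomial.funext fun y => ?_
  rw [kap_eval, map_zero]
  exact hp (WithLp.toLp 2 _) (dif_neg (by simp))

end PartTwo

/-- If `Z_{ijkl}(x) = 0` for all `x ∈ ℝ^n_+` and all indices, then
`H_{ik}(x) = 0` for all `x ∈ ℝ^n_+` and all `i,k ∈ {1,…,n-1}`. -/
theorem statement3 (n : ℕ) (hn : 6 ≤ n) (l₀ : Fin n) (hl₀ : (l₀ : ℕ) = n - 1)
    (d : ℕ) (hd : d = (n - 2) / 2)
    (h : Fin n → Fin n → (Fin n → ℕ) → ℝ)
    (H : Fin n → Fin n → Euc n → ℝ)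
    (hHdef : ∀ i k x, H i k x = ∑ α ∈ MIdx n d, h i k α * ∏ m, x m ^ α m)
    (hsymm : ∀ i k x, H i k x = H k i x)
    (htrace : ∀ x, ∑ i, H i i x = 0)
    (hH1 : ∀ x : Euc n, 0 ≤ x l₀ → ∀ i, H i l₀ x = 0)
    (hH2 : ∀ x : Euc n, x l₀ = 0 → ∀ i, ∑ k, H i k x * x k = 0)
    (hH3 : ∀ x : Euc n, x l₀ = 0 → ∀ i k, pd l₀ (H i k) x = 0)
    (hZ : ∀ x : Euc n, 0 ≤ x l₀ → ∀ i j k l, Zop H i j k l x = 0) :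
    ∀ x : Euc n, 0 ≤ x l₀ → ∀ i k, i ≠ l₀ → k ≠ l₀ → H i k x = 0 := by
  set Q : Fin n → Fin n → MvPolynomial (Fin n) ℝ := fun i k =>
    ∑ α ∈ MIdx n d, MvPolynomial.monomial (Finsupp.equivFunOnFinite.symm α) (h i k α) with hQ
  have hHQ : H = fun i k => fun x : Euc n => MvPolynomial.eval (fun m => x m) (Q i k) := by
    funext i k x
    rw [hHdef, hQ]
    simp only [map_sum, MvPolynomial.eval_monomial]
    refine Finset.sum_congr rfl fun α _ => ?_
    rw [Finsupp.prod_fintype _ _ (by simp)]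
    rfl
  have hHQ' : ∀ i k x, H i k x = MvPolynomial.eval (fun m => x m) (Q i k) := fun i k x => by
    rw [hHQ]
  have kde : ∀ (a b : Fin n) (x : Euc n),
      MvPolynomial.eval (fun m => x m) (dl a b) = kd a b := by
    intro a b x; unfold dl kd; split_ifs <;> simp
  have hA : ∀ i k (x : Euc n), Aop H i k x = MvPolynomial.eval (fun m => x m) (Ap Q i k) := by
    intro i k x
    rw [hHQ]
    simp only [Aop, Ap, pd_eval', map_add, map_sub, map_mul, map_sum, kde, MvPolynomial.eval_C]
  have hZe : ∀ i j k l (x : Euc n),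
      Zop H i j k l x = MvPolynomial.eval (fun m => x m) (Zp Q i j k l) := by
    intro i j k l x
    simp only [Zop, Zp, Rl, KN, hA]
    rw [hHQ]
    simp only [pd_eval', map_add, map_sub, map_mul, kde, MvPolynomial.eval_C]
  have Q0 : ∀ i k, Q i k = 0 := by
    refine poly_main hn l₀ ?_ ?_ ?_ ?_ ?_ ?_
    · intro i k
      refine sub_eq_zero.mp (half_zero l₀ _ fun x _ => ?_)
      rw [map_sub, ← hHQ', ← hHQ', hsymm, sub_self]
    · refine half_zero l₀ _ fun x _ => ?_
      rw [map_sum]; simpa only [← hHQ'] using htrace x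
    · intro i
      refine half_zero l₀ _ fun x hx => ?_
      rw [← hHQ']; exact hH1 x hx i
    · intro i
      refine kap_zero l₀ _ fun x hx => ?_
      simp only [map_sum, map_mul, MvPolynomial.eval_X, ← hHQ']
      exact hH2 x hx i
    · intro i k
      refine kap_zero l₀ _ fun x hx => ?_
      have h1 := hH3 x hx i k
      rw [hHQ] at h1
      simpa only [pd_eval'] using h1
    · intro i j k l
      refine half_zero l₀ _ fun x hx => ?_
      rw [← hZe]; exact hZ x hx i j k l
  intro x _ i k _ _
  rw [hHQ', Q0, map_zero]
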